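/- For the walk driven by the negative discrete second derivative −Δ/2 of its local time, with positive probability X_n / √(2n) → 1 as n → ∞. -/

import Mathlib

open MeasureTheory Real Filter Set

noncomputable section

/-- Number of crossings of the edge `{e, e+1}` (i.e. the half-integer edge `e + 1/2`)
before time `n`. -/
def locTime {Ω : Type*} (X : ℕ → Ω → ℤ) (n : ℕ) (e : ℤ) (ω : Ω) : ℕ :=
  ((Finset.range n).filter fun m => min (X m ω) (X (m + 1) ω) = e).card

/-- Local time profile seen from the walker: `ℓ_n(k + 1/2)`. -/
def shiftedProfile {Ω : Type*} (X : ℕ → Ω → ℤ) (n : ℕ) (k : ℤ) (ω : Ω) : ℕ :=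
  locTime X n (X n ω + k) ω

/-- `F(y) = e^y / (e^y + e^{-y})`. -/
def walkF (y : ℝ) : ℝ := Real.exp y / (Real.exp y + Real.exp (-y))

/-- The σ-algebra generated by `X_0, …, X_n`. -/
def walkFiltration {Ω : Type*} (X : ℕ → Ω → ℤ) (n : ℕ) : MeasurableSpace Ω :=
  ⨆ m ∈ Finset.range (n + 1), MeasurableSpace.comap (X m) inferInstance

/-- The discrete second derivative of the local time profile seen from the walker:
`Δ(ℓ_n) = ℓ_n(-3/2) - ℓ_n(-1/2) - ℓ_n(1/2) + ℓ_n(3/2)`. -/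
def Δ {Ω : Type*} (X : ℕ → Ω → ℤ) (n : ℕ) (ω : Ω) : ℝ :=
  (shiftedProfile X n (-2) ω : ℝ) - shiftedProfile X n (-1) ω
    - shiftedProfile X n 0 ω + shiftedProfile X n 1 ω

/-- The Fermi function `1 / (1 + e^s)`. -/
def fermi (s : ℝ) : ℝ := 1 / (1 + exp s)

lemma fermi_pos (s : ℝ) : 0 < fermi s := by unfold fermi; positivity

lemma fermi_neg (s : ℝ) : fermi (-s) = 1 - fermi s := by
  unfold fermi
  rw [exp_neg]
  have := exp_pos s
  field_simp
  ring

lemma fermi_le_one (s : ℝ) : fermi s ≤ 1 := by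
  have := fermi_pos (-s)
  rw [fermi_neg] at this
  linarith

lemma fermi_le_exp (s : ℝ) : fermi s ≤ exp (-s) := by
  unfold fermi
  rw [exp_neg, ← one_div]
  exact one_div_le_one_div_of_le (exp_pos s) (by linarith)

lemma fermi_mul_le (s : ℝ) :
    fermi s * (1 - fermi s) ≤ 2 * (fermi s - fermi (s + 2)) := by
  have h2 : (2 : ℝ) ≤ exp 2 := by linarith [add_one_le_exp (2 : ℝ)]
  unfold fermi
  rw [exp_add]
  have h := exp_pos s
  set x := exp s
  set y := exp (2 : ℝ)
  have hxy : 0 < x * y := by positivity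
  have key : 2 * (1 / (1 + x) - 1 / (1 + x * y)) - 1 / (1 + x) * (1 - 1 / (1 + x))
      = x * ((y - 2) * x + (2 * y - 3)) / ((1 + x) ^ 2 * (1 + x * y)) := by
    field_simp
    ring
  have hy : 0 ≤ (y - 2) * x := mul_nonneg (by linarith) h.le
  have : 0 ≤ x * ((y - 2) * x + (2 * y - 3)) / ((1 + x) ^ 2 * (1 + x * y)) :=
    div_nonneg (mul_nonneg h.le (by linarith)) (by positivity)
  linarith

/-- The sum of the Fermi function over `s, s + 2, s + 4, …`. -/
def fermiTail (s : ℝ) : ℝ := ∑' j : ℕ, fermi (s + 2 * j)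

lemma exp_neg_two_le : exp (-2 : ℝ) ≤ 1 / 2 := by
  rw [exp_neg, ← one_div]
  exact one_div_le_one_div_of_le (by norm_num) (by linarith [add_one_le_exp (2 : ℝ)])

lemma fermi_term_le (s : ℝ) (j : ℕ) : fermi (s + 2 * j) ≤ exp (-s) * (1 / 2) ^ j := by
  refine (fermi_le_exp _).trans ?_
  rw [show -(s + 2 * (j : ℝ)) = -s + j * (-2) by ring, exp_add, exp_nat_mul]
  gcongr
  exact exp_neg_two_le

lemma summable_fermi (s : ℝ) : Summable fun j : ℕ => fermi (s + 2 * j) :=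
  Summable.of_nonneg_of_le (fun _ => (fermi_pos _).le) (fermi_term_le s)
    (summable_geometric_two.mul_left _)

lemma fermiTail_nonneg (s : ℝ) : 0 ≤ fermiTail s := tsum_nonneg fun _ => (fermi_pos _).le

lemma fermiTail_le (s : ℝ) : fermiTail s ≤ 2 * exp (-s) := by
  refine ((summable_fermi s).tsum_le_tsum (fermi_term_le s)
    (summable_geometric_two.mul_left _)).trans ?_
  rw [tsum_mul_left, tsum_geometric_two, mul_comm]

lemma fermiTail_add_two (s : ℝ) : fermiTail (s + 2) = fermiTail s - fermi s := by
  unfold fermiTail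
  rw [(summable_fermi s).tsum_eq_zero_add]
  simp only [Nat.cast_zero, mul_zero, add_zero, Nat.cast_add, Nat.cast_one]
  rw [add_sub_cancel_left]
  congr 1
  ext j
  ring_nf

lemma fermiTail_refl_step (s : ℝ) (h : fermiTail s = (1 - s) / 2 + fermiTail (2 - s)) :
    fermiTail (s + 2) = (1 - (s + 2)) / 2 + fermiTail (2 - (s + 2)) := by
  have h1 := fermiTail_add_two s
  have h2 := fermiTail_add_two (-s)
  have h3 := fermi_neg s
  rw [show 2 - (s + 2) = -s by ring]
  rw [show -s + 2 = 2 - s by ring] at h2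
  linarith

lemma fermiTail_refl_nat (n : ℕ) :
    fermiTail n = (1 - n) / 2 + fermiTail (2 - n) := by
  induction n using Nat.twoStepInduction with
  | zero =>
    have h1 := fermiTail_add_two 0
    have h3 : fermi 0 = 1 / 2 := by unfold fermi; norm_num
    norm_num at h1 ⊢
    linarith
  | one => norm_num
  | more n ih _ =>
    have := fermiTail_refl_step n ih
    push_cast
    exact this

lemma fermiTail_refl (s : ℤ) :
    fermiTail s = (1 - s) / 2 + fermiTail (2 - s) := by
  obtain ⟨n, rfl | rfl⟩ := s.eq_nat_or_neg
  · exact_mod_cast fermiTail_refl_nat n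
  · have := fermiTail_refl_nat (n + 2)
    push_cast at this ⊢
    rw [show (2 : ℝ) - (n + 2) = -n by ring] at this
    rw [show (2 : ℝ) - -n = n + 2 by ring]
    linarith

lemma fermiTail_le_linear (s : ℤ) {x : ℝ} (hx : 0 ≤ x) (h : -x ≤ s) :
    fermiTail s ≤ (x + 5) / 2 := by
  rcases le_or_gt 0 s with h0 | h0
  · have h0' : (0 : ℝ) ≤ s := by exact_mod_cast h0
    have := fermiTail_le s
    have : exp (-(s : ℝ)) ≤ 1 := exp_le_one_iff.2 (by linarith)
    linarith
  · have h0' : (s : ℝ) < 0 := by exact_mod_cast h0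
    have := fermiTail_le (2 - s)
    have : exp (-(2 - (s : ℝ))) ≤ 1 := exp_le_one_iff.2 (by linarith)
    rw [fermiTail_refl]
    linarith

lemma exp_le_quadratic {x : ℝ} (hx : |x| ≤ 1) : exp x ≤ 1 + x + x ^ 2 := by
  have := abs_le.1 (abs_exp_sub_one_sub_id_le hx)
  linarith

/-- Exponential moment bound for a centred two-point variable. -/
lemma two_point_exp_le {q l : ℝ} (h0 : 0 ≤ q) (h1 : q ≤ 1) (hl : |l| ≤ 1 / 2) :
    q * exp (2 * l * (1 - q)) + (1 - q) * exp (-(2 * l * q)) ≤ exp (4 * l ^ 2 * (q * (1 - q))) := by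
  have e1 : exp (2 * l * (1 - q)) ≤ _ := exp_le_quadratic (x := 2 * l * (1 - q)) (by
    rw [abs_mul, abs_mul, abs_of_nonneg (sub_nonneg.2 h1), abs_two]; nlinarith [abs_nonneg l])
  have e2 : exp (-(2 * l * q)) ≤ _ := exp_le_quadratic (x := -(2 * l * q)) (by
    rw [abs_neg, abs_mul, abs_mul, abs_of_nonneg h0, abs_two]; nlinarith [abs_nonneg l])
  have e3 := add_one_le_exp (4 * l ^ 2 * (q * (1 - q)))
  have f1 := mul_le_mul_of_nonneg_left e1 h0
  have f2 := mul_le_mul_of_nonneg_left e2 (sub_nonneg.2 h1)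
  nlinarith

lemma two_point_step {q l e A B : ℝ} (h0 : 0 ≤ q) (h1 : q ≤ 1) (hl : |l| ≤ 1 / 2)
    (he0 : 0 ≤ e) (he1 : e ≤ 1)
    (hA : A ≤ q * exp (2 * l * (1 - q) - 4 * l ^ 2 * (q * (1 - q)) + e))
    (hB : B ≤ (1 - q) * exp (-(2 * l * q) - 4 * l ^ 2 * (q * (1 - q)) + e)) :
    A + B ≤ 1 + 2 * e := by
  have h := two_point_exp_le h0 h1 hl
  have h2 : exp e ≤ 1 + 2 * e := by
    have := exp_le_quadratic (x := e) (by rw [abs_of_nonneg he0]; exact he1)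
    nlinarith
  rw [exp_add, exp_sub] at hA hB
  have hp := exp_pos (4 * l ^ 2 * (q * (1 - q)))
  have hm := (div_le_one hp).2 h
  have := mul_le_mul_of_nonneg_right hm (exp_pos e).le
  have e4 : (q * exp (2 * l * (1 - q)) + (1 - q) * exp (-(2 * l * q)))
      / exp (4 * l ^ 2 * (q * (1 - q))) * exp e =
      q * (exp (2 * l * (1 - q)) / exp (4 * l ^ 2 * (q * (1 - q))) * exp e) +
      (1 - q) * (exp (-(2 * l * q)) / exp (4 * l ^ 2 * (q * (1 - q))) * exp e) := by ring
  linarith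

/-- Distance of the walker to its running maximum: `0`, `1` or `2`. -/
inductive Phase
  | front
  | mid
  | back

/-- Local description of the walk near its running maximum `M`. The four fields after `M` are the
local times of the edges `M - 4`, `M - 3`, `M - 2`, `M - 1`, where an edge that the walker still
has to cross in order to return to `M` is counted once more, and `R` is the total time spent to the
left of the vertex `M - 2`. -/
structure FrontState where
  phase : Phase
  M : ℤ
  a' : ℤ
  a : ℤ
  b : ℤ
  c : ℤ
  R : ℤ

namespace FrontState

/-- The effect of a step (`true` is a step to the right). -/
def next : FrontState → Bool → FrontState
  | ⟨.front, M, _, a, b, c, R⟩, true => ⟨.front, M + 1, a, b, c, 1, R + b⟩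
  | ⟨.front, M, a', a, b, c, R⟩, false => ⟨.mid, M, a', a, b, c + 2, R⟩
  | ⟨.mid, M, a', a, b, c, R⟩, true => ⟨.front, M, a', a, b, c, R⟩
  | ⟨.mid, M, a', a, b, c, R⟩, false => ⟨.back, M, a', a, b + 2, c, R⟩
  | ⟨.back, M, a', a, b, c, R⟩, true => ⟨.mid, M, a', a, b, c, R⟩
  | ⟨.back, M, a', a, b, c, R⟩, false => ⟨.back, M, a', a, b, c, R⟩

/-- The distance of the walker to its running maximum. -/
def lag (t : FrontState) : ℤ :=
  match t.phase with
  | .front => 0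
  | .mid => 1
  | .back => 2

/-- The value of `-Δ`. -/
def drift (t : FrontState) : ℤ :=
  match t.phase with
  | .front => t.c - t.b
  | .mid => t.b + t.c - 1 - t.a
  | .back => t.a + t.b - t.a' - t.c

/-- The value of `-Δ` at the next visit to the vertex `M - 1`. -/
def nextDrift (t : FrontState) : ℤ :=
  match t.phase with
  | .front => t.b + t.c + 1 - t.a
  | _ => t.b + t.c - 1 - t.a

/-- A step in a given direction has probability `fermi cost`. -/
def cost (t : FrontState) (r : Bool) : ℤ := if r then -t.drift else t.drift

/-- The number of steps made so far. -/
def time (t : FrontState) : ℤ := t.R + t.b + t.c - t.lag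

/-- The threshold beyond which steps against the drift are considered rare. -/
def threshold (t : FrontState) : ℝ := 4 * log t.M

/-- The predicted final local time of the edge `M - 1`, up to an additive constant. -/
def pred (t : FrontState) : ℝ :=
  t.b + 2 * fermiTail t.nextDrift + 2 * fermiTail (2 - (t.c - t.b))

/-- The term that compensates the variance of `pred`. -/
def comp (t : FrontState) : ℝ := fermi t.nextDrift + fermi (t.c - t.b)

/-- The exponential weight. -/
def weight (l : ℝ) (t : FrontState) : ℝ :=
  exp (l * (t.pred - t.M) + 8 * l ^ 2 * (t.comp - t.M))

/-- A step against a large drift. -/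
def Rare (t : FrontState) (r : Bool) : Prop := t.threshold ≤ t.cost r

/-- The prediction is close to its typical value. -/
def Balanced (t : FrontState) : Prop := |t.pred - t.M| ≤ t.M / 10

/-- The structural properties that hold as long as the walk makes no rare step. -/
structure Inv (t : FrontState) : Prop where
  four_million_le : (4000000 : ℝ) ≤ t.M
  a_sub_le : (t.a' : ℝ) - t.a ≤ t.threshold + 2
  le_b : (t.a : ℝ) - t.threshold ≤ t.b
  b_le : (t.b : ℝ) ≤ t.a + t.threshold + 2
  one_le_c : (1 : ℝ) ≤ t.c
  c_le : (t.c : ℝ) ≤ t.b + t.threshold + 2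
  c_le_of_back : t.phase = .back → (t.c : ℝ) ≤ 2 * t.threshold + 1
  R_le : (t.R : ℝ) ≤ t.M ^ 2
  b_le_two_mul : (t.b : ℝ) ≤ 2 * t.M

lemma threshold_le {t : FrontState} (h : (4000000 : ℝ) ≤ t.M) : t.threshold ≤ t.M / 250 := by
  unfold threshold
  have h0 : (0 : ℝ) ≤ t.M := by linarith
  have h1 : (2000 : ℝ) ≤ √t.M := by
    apply Real.le_sqrt_of_sq_le; linarith
  have h2 : log t.M = 2 * log √t.M := by rw [Real.log_sqrt h0]; ring
  have h3 := log_le_sub_one_of_pos (x := √t.M) (by linarith)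
  have h4 := Real.mul_self_sqrt h0
  nlinarith

lemma threshold_nonneg {t : FrontState} (h : (4000000 : ℝ) ≤ t.M) : 0 ≤ t.threshold := by
  unfold threshold
  have := log_nonneg (x := t.M) (by linarith)
  linarith

lemma one_le_threshold {t : FrontState} (h : (4000000 : ℝ) ≤ t.M) : 1 ≤ t.threshold := by
  unfold threshold
  have : 1 ≤ log (t.M : ℝ) := by
    rw [Real.le_log_iff_exp_le (by linarith)]
    linarith [exp_one_lt_d9]
  linarith

lemma exp_neg_threshold {t : FrontState} (h : (4000000 : ℝ) ≤ t.M) :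
    exp (-t.threshold) = ((t.M : ℝ) ^ 4)⁻¹ := by
  unfold threshold
  rw [exp_neg, show 4 * log (t.M : ℝ) = (4 : ℕ) * log t.M by norm_num, exp_nat_mul,
    exp_log (by linarith)]

lemma neg_threshold_le_nextDrift {t : FrontState} (h : t.Inv) :
    -t.threshold ≤ t.nextDrift := by
  have := h.le_b
  have := h.one_le_c
  unfold nextDrift
  split <;> push_cast <;> linarith

lemma pred_le {t : FrontState} (h : t.Inv) : t.pred ≤ t.b + 2 * t.threshold + 10 := by
  have h0 := threshold_nonneg h.four_million_le
  have h1 := fermiTail_le_linear t.nextDrift h0 (neg_threshold_le_nextDrift h)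
  have h2 := fermiTail_le_linear (2 - (t.c - t.b)) h0 (by push_cast; linarith [h.c_le])
  push_cast at h2
  unfold pred
  linarith

lemma le_pred (t : FrontState) : t.b ≤ t.pred := by
  unfold pred
  have := fermiTail_nonneg t.nextDrift
  have := fermiTail_nonneg (2 - (t.c - t.b))
  linarith

lemma rare_of_back {t : FrontState} (h : t.Inv) (hb : t.Balanced) (hp : t.phase = .back) :
    t.Rare false := by
  have hB := abs_le.1 hb
  have hpl := pred_le h
  have ht := threshold_le h.four_million_le
  have h1 := h.four_million_le
  have h2 := h.a_sub_le
  have h7 := h.c_le_of_back hp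
  simp only [Rare, cost, drift, hp, Bool.false_eq_true, if_false]
  push_cast
  linarith

lemma Inv.next {t : FrontState} (h : t.Inv) (hb : t.Balanced) {r : Bool} (hr : ¬ t.Rare r) :
    (t.next r).Inv := by
  have hp := abs_le.1 hb
  have hpl := pred_le h
  have hlp := le_pred t
  have h0 := one_le_threshold h.four_million_le
  have ht := threshold_le h.four_million_le
  obtain ⟨i1, i2, i3, i4, i5, i6, i7, i8, i9⟩ := h
  unfold Rare at hr
  push Not at hr
  obtain ⟨p, M, a', a, b, c, R⟩ := t
  have hmono : threshold ⟨p, M, a', a, b, c, R⟩ ≤ 4 * log (M + 1) := by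
    unfold threshold
    simp only at i1 ⊢
    have := log_le_log (x := (M : ℝ)) (y := M + 1) (by linarith) (by linarith)
    linarith
  have hth : ∀ p' a₁ a₂ b' c' R', threshold ⟨p', M, a₁, a₂, b', c', R'⟩
    = threshold ⟨p, M, a', a, b, c, R⟩ := fun _ _ _ _ _ _ => rfl
  have hth' : ∀ p' a₁ a₂ b' c' R', threshold ⟨p', M + 1, a₁, a₂, b', c', R'⟩
    = 4 * log (M + 1) := fun _ _ _ _ _ _ => by simp [threshold]
  generalize pred _ = P at *
  cases p <;> cases r <;> simp only [FrontState.next, cost, drift] at * <;>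
    constructor <;> simp only [hth, hth'] <;>
    generalize threshold _ = H at * <;>
    generalize (4 * log ((M : ℝ) + 1)) = H' at * <;> push_cast at * <;>
    first
      | linarith
      | nlinarith
      | (intro _; linarith)
      | exact fun _ => i7 trivial
      | (intro h; cases h)

lemma time_le {t : FrontState} (h : t.Inv) : (t.time : ℝ) ≤ 2 * t.M ^ 2 := by
  have ht := threshold_le h.four_million_le
  obtain ⟨i1, i2, i3, i4, i5, i6, i7, i8, i9⟩ := h
  have : (0 : ℝ) ≤ t.lag := by
    unfold lag; split <;> norm_num
  unfold time
  push_cast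
  nlinarith

end FrontState

namespace FrontState

lemma weight_le_mul_exp {l y : ℝ} {t t' : FrontState}
    (h : l * ((t'.pred - t'.M) - (t.pred - t.M))
      + 8 * l ^ 2 * ((t'.comp - t'.M) - (t.comp - t.M)) ≤ y) :
    weight l t' ≤ weight l t * exp y := by
  unfold weight
  rw [← exp_add, exp_le_exp]
  linarith

lemma mul_le_abs_mul {l x d : ℝ} (hl : |l| ≤ 1 / 2) (hx : |x| ≤ d) : l * x ≤ d / 2 := by
  have h1 := le_abs_self (l * x)
  rw [abs_mul] at h1
  have := mul_le_mul hl hx (abs_nonneg _) (by norm_num)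
  linarith

lemma sq_le_of_abs {l : ℝ} (hl : |l| ≤ 1 / 2) : l ^ 2 ≤ 1 / 4 := by
  have := sq_le_sq' (abs_le.1 hl).1 (abs_le.1 hl).2
  norm_num at this ⊢
  linarith

/-- One-step estimate for the exponential weight along non-rare steps. -/
lemma weight_step {t : FrontState} (h : t.Inv) (hb : t.Balanced) {l : ℝ} (hl : |l| ≤ 1 / 2)
    [∀ r, Decidable (t.Rare r)] :
    fermi (t.cost false) * (if t.Rare false then 0 else weight l (t.next false)) +
      fermi (t.cost true) * (if t.Rare true then 0 else weight l (t.next true))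
      ≤ (1 + 6 * exp (-t.threshold)) * weight l t := by
  have hB := abs_le.1 hb
  have hpl := pred_le h
  have hη : exp (-t.threshold) ≤ 1 / 3 := by
    rw [exp_neg_threshold h.four_million_le, ← one_div]
    apply one_div_le_one_div_of_le (by norm_num)
    have h1 := h.four_million_le
    have := pow_le_pow_left₀ (by norm_num) h1 4
    norm_num at this ⊢
    linarith
  have hη0 := exp_pos (-t.threshold)
  have hthr := threshold_le h.four_million_le
  have hl2 := sq_le_of_abs hl
  have hw : 0 < weight l t := exp_pos _
  have hc0 : fermi (t.cost true) = 1 - fermi (t.cost false) := by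
    rw [← fermi_neg]; simp [cost]
  rw [hc0]
  set q := fermi (t.cost false) with hq
  have hq0 : 0 < q := fermi_pos _
  have hq1 : q ≤ 1 := fermi_le_one _
  suffices H : (¬ t.Rare false → weight l (t.next false) ≤ weight l t *
        exp (2 * l * (1 - q) - 4 * l ^ 2 * (q * (1 - q)) + 3 * exp (-t.threshold))) ∧
      (¬ t.Rare true → weight l (t.next true) ≤ weight l t *
        exp (-(2 * l * q) - 4 * l ^ 2 * (q * (1 - q)) + 3 * exp (-t.threshold))) ∨
        t.phase = .back by
    rcases H with H | H
    · have key : ∀ p x y : ℝ, ∀ P : Prop, ∀ _ : Decidable P, 0 ≤ p →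
          (¬ P → x ≤ weight l t * exp y) → p * (if P then 0 else x) / weight l t ≤ p * exp y := by
        intro p x y P _ hp hx
        split_ifs with hP
        · simp only [mul_zero, zero_div]; positivity
        · rw [div_le_iff₀ hw]
          have := mul_le_mul_of_nonneg_left (hx hP) hp
          linarith
      have := two_point_step hq0.le hq1 hl (by positivity) (by linarith)
        (key q _ _ _ inferInstance hq0.le H.1) (key (1 - q) _ _ _ inferInstance (by linarith) H.2)
      rw [← add_div, div_le_iff₀ hw] at this
      linarith
    · rw [if_pos (rare_of_back h hb H)]
      have : weight l (t.next true) = weight l t := by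
        obtain ⟨p, M, a', a, b, c, R⟩ := t
        simp only at H
        subst H
        rfl
      have h2 : (if t.Rare true then 0 else weight l (t.next true)) ≤ weight l t := by
        split_ifs
        · exact hw.le
        · exact this.le
      have h3 := mul_le_mul_of_nonneg_left h2 (sub_nonneg.2 hq1)
      nlinarith [mul_pos hη0 hw, mul_pos hq0 hw]
  have hql := fermi_mul_le (t.cost false)
  rw [← hq] at hql
  have hsq : 0 ≤ l ^ 2 := sq_nonneg l
  obtain ⟨i1, i2, i3, i4, i5, i6, i7, i8, i9⟩ := h
  generalize hP : pred t = P at hpl hB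
  have hmul : ∀ x y : ℝ, x ≤ y → 8 * l ^ 2 * x ≤ 8 * l ^ 2 * y := fun x y hxy =>
    mul_le_mul_of_nonneg_left hxy (by positivity)
  obtain ⟨p, M, a', a, b, c, R⟩ := t
  cases p
  · left
    simp only [cost, drift, Bool.false_eq_true, if_false, Rare, if_true] at *
    push_cast at *
    have t1 := fermiTail_add_two (-((c : ℝ) - b))
    rw [fermi_neg, ← hq] at t1
    constructor
    · intro hr
      apply weight_le_mul_exp
      simp only [next, pred, comp, nextDrift] at *
      push_cast
      rw [show (b : ℝ) + (c + 2) - 1 - a = b + c + 1 - a by ring,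
        show (2 : ℝ) - (c + 2 - b) = -(c - b) by ring,
        show (c : ℝ) + 2 - b = c - b + 2 by ring]
      rw [show -((c : ℝ) - b) + 2 = 2 - (c - b) by ring] at t1
      rw [t1, ← hq]
      have := hmul _ (-(1 / 2) * (q * (1 - q))) (show fermi ((c : ℝ) - b + 2) - q
        ≤ -(1 / 2) * (q * (1 - q)) by linarith)
      linarith
    · intro hr
      push Not at hr
      apply weight_le_mul_exp
      have t2 := fermiTail_refl (c - b)
      push_cast at t2
      have t3 := fermiTail_add_two (c - b)
      rw [← hq] at t3
      simp only [next, pred, comp, nextDrift] at *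
      push_cast at *
      rw [show (2 : ℝ) - (1 - c) = c + 1 by ring, show (c : ℝ) + 1 + 1 - b = c - b + 2 by ring]
      have e1 := fermiTail_le (c + 1)
      have e2 := fermiTail_le (b + c + 1 - a)
      have e1' := fermiTail_nonneg (c + 1)
      have e2' := fermiTail_nonneg (b + c + 1 - a)
      generalize threshold _ = H at *
      have g1 : exp (-((c : ℝ) + 1)) ≤ exp (-H) := exp_le_exp.2 (by linarith)
      have g2 : exp (-((b : ℝ) + c + 1 - a)) ≤ exp (-H) := exp_le_exp.2 (by linarith)
      have := hmul _ (-(1 / 2) * (q * (1 - q))) (show fermi ((c : ℝ) - b + 2) + fermi (1 - c)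
        - (M + 1) - (fermi (b + c + 1 - a) + q - M)
        ≤ -(1 / 2) * (q * (1 - q)) by
          linarith [fermi_le_one (1 - c), fermi_pos (b + c + 1 - a)])
      have h5 := mul_le_abs_mul hl (x := 2 * fermiTail (c + 1) - 2 * fermiTail (b + c + 1 - a))
        (d := 4 * exp (-H)) (by rw [abs_le]; constructor <;> linarith)
      have h6 : c + 2 * fermiTail ((c : ℝ) - b + 2) + 2 * fermiTail (c + 1) - (M + 1) -
          (b + 2 * fermiTail (b + c + 1 - a) + 2 * fermiTail (2 - (c - b)) - M)
          = - 2 * q + (2 * fermiTail (c + 1) - 2 * fermiTail (b + c + 1 - a)) := by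
        linarith
      rw [h6, ← hq]
      linarith
  · left
    simp only [cost, drift, Bool.false_eq_true, if_false, Rare, if_true] at *
    push_cast at *
    have t1 := fermiTail_add_two ((b : ℝ) + c - 1 - a)
    rw [← hq] at t1
    constructor
    · intro hr
      push Not at hr
      apply weight_le_mul_exp
      simp only [next, pred, comp, nextDrift] at *
      push_cast at *
      rw [show (b : ℝ) + 2 + c - 1 - a = b + c - 1 - a + 2 by ring,
        show (2 : ℝ) - (c - (b + 2)) = 2 - (c - b) + 2 by ring,
        fermiTail_add_two (2 - (c - b)), t1]
      generalize threshold _ = H at *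
      have e1 := fermi_le_exp (2 - (c - b))
      have e1' := fermi_pos (2 - (c - b))
      have e2 := fermi_le_exp (-(c - b))
      rw [fermi_neg] at e2
      have e3 := fermi_le_one (c - (b + 2))
      have g1 : exp (-((2 : ℝ) - (c - b))) ≤ exp (-H) := exp_le_exp.2 (by linarith)
      have g2 : exp (-(-((c : ℝ) - b))) ≤ exp (-H) := exp_le_exp.2 (by linarith)
      have h5 := mul_le_abs_mul hl (x := - 2 * fermi (2 - (c - b)))
        (d := 2 * exp (-H)) (by rw [abs_le]; constructor <;> linarith)
      have h6 := hmul _ (-(1 / 2) * (q * (1 - q)) + exp (-H)) (show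
        fermi ((b : ℝ) + c - 1 - a + 2) + fermi (c - (b + 2)) - M - (q + fermi (c - b) - M) ≤
          -(1 / 2) * (q * (1 - q)) + exp (-H) by linarith)
      have h7 : 8 * l ^ 2 * exp (-H) ≤ 2 * exp (-H) := by nlinarith
      rw [← hq]
      linarith
    · intro hr
      apply weight_le_mul_exp
      simp only [next, pred, comp, nextDrift] at *
      push_cast
      rw [show (b : ℝ) + c + 1 - a = b + c - 1 - a + 2 by ring, t1, ← hq]
      have := hmul _ (-(1 / 2) * (q * (1 - q))) (show fermi ((b : ℝ) + c - 1 - a + 2) - q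
        ≤ -(1 / 2) * (q * (1 - q)) by linarith)
      linarith
  · right; rfl

end FrontState

/-- Position after the steps of `w` (latest step first, `true` is a step to the right). -/
def wordPos : List Bool → ℤ
  | [] => 0
  | r :: w => wordPos w + if r then 1 else -1

/-- Number of crossings of the edge `{e, e + 1}` along the steps of `w`. -/
def wordLocTime : List Bool → ℤ → ℕ
  | [], _ => 0
  | r :: w, e => wordLocTime w e + if (if r then wordPos w else wordPos w - 1) = e then 1 else 0

/-- The second derivative of the local time seen from the walker. -/
def wordDelta (w : List Bool) : ℤ :=
  wordLocTime w (wordPos w - 2) - wordLocTime w (wordPos w - 1) - wordLocTime w (wordPos w)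
    + wordLocTime w (wordPos w + 1)

/-- After `w`, a step in direction `r` has probability `fermi (wordCost w r)`. -/
def wordCost (w : List Bool) (r : Bool) : ℤ := if r then wordDelta w else -wordDelta w

namespace FrontState

/-- The front state `t` describes the walk after the steps of `w`. -/
structure Describes (t : FrontState) (w : List Bool) : Prop where
  pos_eq : wordPos w = t.M - t.lag
  right_eq : ∀ j, t.M ≤ j → wordLocTime w j = 0
  c_eq : (wordLocTime w (t.M - 1) : ℤ) = t.c - min t.lag 1
  b_eq : (wordLocTime w (t.M - 2) : ℤ) = t.b - max (t.lag - 1) 0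
  a_eq : (wordLocTime w (t.M - 3) : ℤ) = t.a
  a'_eq : (wordLocTime w (t.M - 4) : ℤ) = t.a'
  length_eq : (w.length : ℤ) = t.time

lemma Describes.wordCost_eq {t : FrontState} {w : List Bool} (h : t.Describes w) (r : Bool) :
    wordCost w r = t.cost r := by
  obtain ⟨h1, h2, h3, h4, h5, h6, h7⟩ := h
  have hD : wordDelta w = -t.drift := by
    obtain ⟨p, M, a', a, b, c, R⟩ := t
    have r0 := h2 M le_rfl
    have r1 := h2 (M + 1) (by simp)
    unfold wordDelta
    cases p <;> simp only [lag, drift] at * <;> rw [h1]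
    · simp only [sub_zero]
      rw [h3, h4, r0, r1]
      norm_num
    · rw [show M - 1 - 2 = M - 3 by ring, show M - 1 - 1 = M - 2 by ring,
        show M - 1 + 1 = M by ring, h3, h4, h5, r0]
      norm_num
      ring
    · rw [show M - 2 - 2 = M - 4 by ring, show M - 2 - 1 = M - 3 by ring,
        show M - 2 + 1 = M - 1 by ring, h3, h4, h5, h6]
      norm_num
      ring
  cases r <;> simp [wordCost, cost, hD]

lemma Describes.next {t : FrontState} {w : List Bool} (h : t.Describes w) {r : Bool}
    (hr : t.phase = .back → r = true) : (t.next r).Describes (r :: w) := by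
  obtain ⟨h1, h2, h3, h4, h5, h6, h7⟩ := h
  obtain ⟨p, M, a', a, b, c, R⟩ := t
  cases p <;> cases r
  case back.false => simp at hr
  all_goals
    simp only [lag, time] at h1 h3 h4 h5 h6 h7
    simp only at h2
    constructor <;>
      simp only [FrontState.next, lag, time, wordPos, wordLocTime, h1, List.length_cons,
        if_true, Bool.false_eq_true, if_false] <;> push_cast
  all_goals first
    | (intro j hj; rw [h2 j (by omega), if_neg (by omega)])
    | skip
  all_goals first
    | omega
    | skip
  · rw [h2 _ (by omega)]; simp
  · rw [show M + 1 - 2 = M - 1 by ring, h3]; simp; omega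
  · rw [show M + 1 - 3 = M - 2 by ring, h4]; simp; omega
  · rw [show M + 1 - 4 = M - 3 by ring, h5]; simp; omega

open Classical in
/-- One step of the front state, which is lost if the prediction is off or the step is rare. -/
def step (t : Option FrontState) (r : Bool) : Option FrontState :=
  match t with
  | none => none
  | some t => if t.Balanced ∧ ¬ t.Rare r then some (t.next r) else none

/-- The front state `m` steps after the word `A`, at which the state is `t`. -/
def trajectory (A : List Bool) (t : FrontState) : ℕ → List Bool → Option FrontState
  | 0, w => open Classical in if w = A then some t else none
  | _ + 1, [] => none
  | m + 1, r :: w => step (trajectory A t m w) r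

lemma step_eq_some {s : Option FrontState} {r : Bool} {t' : FrontState} (h : step s r = some t') :
    ∃ t, s = some t ∧ t.Balanced ∧ ¬ t.Rare r ∧ t' = t.next r := by
  match s with
  | none => simp [step] at h
  | some t =>
    simp only [step] at h
    split_ifs at h with h1
    exact ⟨t, rfl, h1.1, h1.2, by simpa using h.symm⟩

lemma trajectory_spec {A : List Bool} {t₀ : FrontState} (hd : t₀.Describes A) (hi : t₀.Inv) :
    ∀ {m : ℕ} {w : List Bool} {t : FrontState}, trajectory A t₀ m w = some t →
      t.Inv ∧ t.Describes w
  | 0, w, t, h => by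
    simp only [trajectory] at h
    split_ifs at h with hw
    simp only [Option.some.injEq] at h
    subst h hw
    exact ⟨hi, hd⟩
  | m + 1, [], t, h => by simp [trajectory] at h
  | m + 1, r :: w, t', h => by
    obtain ⟨t, h1, h2, h3, rfl⟩ := step_eq_some h
    obtain ⟨i, d⟩ := trajectory_spec hd hi h1
    refine ⟨i.next h2 h3, d.next fun hb => ?_⟩
    cases r
    · exact absurd (rare_of_back i h2 hb) h3
    · rfl

end FrontState

/-- Crossing the edge to the right of the current position `2 r + 1` times. -/
def crossWord : ℕ → List Bool → List Bool
  | 0, w => true :: w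
  | r + 1, w => true :: false :: crossWord r w

lemma wordPos_crossWord (r : ℕ) (w : List Bool) : wordPos (crossWord r w) = wordPos w + 1 := by
  induction r with
  | zero => simp [crossWord, wordPos]
  | succ r ih => simp [crossWord, wordPos, ih]

lemma length_crossWord (r : ℕ) (w : List Bool) :
    (crossWord r w).length = w.length + (2 * r + 1) := by
  induction r with
  | zero => simp [crossWord]
  | succ r ih => simp [crossWord, ih]; ring

lemma wordLocTime_crossWord (r : ℕ) (w : List Bool) (e : ℤ) :
    wordLocTime (crossWord r w) e = wordLocTime w e + if wordPos w = e then 2 * r + 1 else 0 := by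
  induction r with
  | zero => simp [crossWord, wordLocTime]
  | succ r ih =>
    simp only [crossWord, wordLocTime, wordPos, ih, wordPos_crossWord]
    simp only [Bool.false_eq_true, if_false, if_true]
    split_ifs <;> omega

lemma wordPos_replicate (n : ℕ) : wordPos (List.replicate n true) = n := by
  induction n with
  | zero => simp [wordPos]
  | succ n ih => simp [List.replicate_succ, wordPos, ih]

lemma wordLocTime_replicate (n : ℕ) {e : ℤ} (he : n ≤ e) :
    wordLocTime (List.replicate n true) e = 0 := by
  induction n with
  | zero => simp [wordLocTime]
  | succ n ih =>
    push_cast at he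
    simp only [List.replicate_succ, wordLocTime, wordPos_replicate]
    rw [ih (by omega)]
    simp
    omega

namespace FrontState

/-- A front state with flat profile of height `M = 2 r + 1`. -/
def initial (r : ℕ) : FrontState :=
  ⟨.front, 2 * r + 1, 2 * r + 1, 2 * r + 1, 2 * r + 1, 1, 6 * r - 1⟩

/-- A word that leads to the front state `initial r`. -/
def initialWord (r : ℕ) : List Bool :=
  true :: crossWord r (crossWord r (crossWord r (List.replicate (2 * r - 3) true)))

lemma initial_describes {r : ℕ} (hr : 2 ≤ r) : (initial r).Describes (initialWord r) := by
  obtain ⟨k, rfl⟩ := Nat.exists_eq_add_of_le hr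
  have h : 2 * (2 + k) - 3 = 2 * k + 1 := by omega
  constructor
  all_goals simp only [initialWord, initial, wordPos, wordLocTime, wordPos_crossWord,
    wordLocTime_crossWord, length_crossWord, List.length_cons, List.length_replicate,
    wordPos_replicate, lag, time, if_true, h]
  · push_cast; ring
  · intro j hj
    push_cast at hj ⊢
    rw [wordLocTime_replicate _ (by push_cast; omega)]
    split_ifs <;> omega
  all_goals
    try rw [wordLocTime_replicate _ (by push_cast; omega)]
    push_cast
    try split_ifs
  all_goals omega

lemma initial_inv {r : ℕ} (hr : 2000000 ≤ r) : (initial r).Inv := by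
  have h' : (2000000 : ℝ) ≤ r := by exact_mod_cast hr
  have h : (4000000 : ℝ) ≤ (initial r).M := by
    simp only [initial]; push_cast; linarith
  have h0 := threshold_nonneg h
  refine ⟨h, ?_, ?_, ?_, ?_, ?_, ?_, ?_, ?_⟩ <;> generalize threshold _ = H at * <;>
    simp only [initial] <;> push_cast <;> first | linarith | nlinarith | simp

lemma initial_pred_sub (r : ℕ) : |(initial r).pred - (initial r).M| ≤ 9 := by
  have h1 := fermiTail_nonneg (initial r).nextDrift
  have h2 := fermiTail_nonneg (2 - ((initial r).c - (initial r).b))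
  have h3 := fermiTail_le_linear (initial r).nextDrift (x := 0) le_rfl
    (by simp only [initial, nextDrift]; push_cast; linarith)
  have h4 := fermiTail_le (2 - ((initial r).c - (initial r).b))
  have h5 : exp (-(2 - (((initial r).c : ℝ) - (initial r).b))) ≤ 1 := by
    rw [exp_le_one_iff]
    simp only [initial]
    push_cast
    have : (0 : ℝ) ≤ r := by positivity
    linarith
  have h6 : ((initial r).b : ℝ) = (initial r).M := rfl
  unfold pred
  rw [abs_le]
  constructor <;> linarith

end FrontState

section Walk

variable {Ω : Type*}

/-- The steps made before time `n`, latest step first. -/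
def pathWord (X : ℕ → Ω → ℤ) : ℕ → Ω → List Bool
  | 0, _ => []
  | n + 1, ω => decide (X (n + 1) ω = X n ω + 1) :: pathWord X n ω

lemma length_pathWord (X : ℕ → Ω → ℤ) (n : ℕ) (ω : Ω) : (pathWord X n ω).length = n := by
  induction n with
  | zero => rfl
  | succ n ih => simp [pathWord, ih]

lemma pathWord_spec {X : ℕ → Ω → ℤ} {ω : Ω} (h0 : X 0 ω = 0)
    (hs : ∀ n, |X (n + 1) ω - X n ω| = 1) (n : ℕ) :
    wordPos (pathWord X n ω) = X n ω ∧
      ∀ e, wordLocTime (pathWord X n ω) e = locTime X n e ω := by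
  induction n with
  | zero => simp [pathWord, wordPos, h0, wordLocTime, locTime]
  | succ n ih =>
    obtain ⟨ih1, ih2⟩ := ih
    have key : X (n + 1) ω = X n ω + 1 ∨ X (n + 1) ω = X n ω - 1 := by
      rcases (abs_eq zero_le_one).1 (hs n) with h | h <;> omega
    constructor
    · rcases key with h | h <;> simp [pathWord, wordPos, ih1, h]
      omega
    · intro e
      have h2 := ih2 e
      unfold locTime at h2 ⊢
      rw [Finset.range_add_one, Finset.filter_insert]
      simp only [pathWord, wordLocTime, ih1, h2, decide_eq_true_eq]
      have h3 : (if X (n + 1) ω = X n ω + 1 then X n ω else X n ω - 1)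
          = min (X n ω) (X (n + 1) ω) := by
        rcases key with h | h <;> rw [h] <;> split_ifs <;> omega
      rw [h3]
      by_cases h4 : min (X n ω) (X (n + 1) ω) = e
      · rw [if_pos h4, if_pos h4, Finset.card_insert_of_notMem (by simp)]
      · rw [if_neg h4, if_neg h4, add_zero]

lemma walkF_eq_fermi (y : ℝ) : walkF (-y / 2) = fermi y := by
  unfold walkF fermi
  have h : exp (-(-y / 2)) = exp (-y / 2) * exp y := by rw [← exp_add]; ring_nf
  rw [h]
  have := exp_pos (-y / 2)
  have := exp_pos y
  field_simp

lemma walkF_delta_eq {X : ℕ → Ω → ℤ} {ω : Ω} (h0 : X 0 ω = 0)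
    (hs : ∀ n, |X (n + 1) ω - X n ω| = 1) (n : ℕ) :
    walkF (-(Δ X n ω) / 2) = fermi (wordCost (pathWord X n ω) true) := by
  obtain ⟨h1, h2⟩ := pathWord_spec h0 hs n
  rw [walkF_eq_fermi]
  congr 1
  simp only [Δ, shiftedProfile, wordCost, wordDelta, h1, h2, if_true]
  push_cast
  rw [← sub_eq_add_neg, ← sub_eq_add_neg, add_zero]

lemma measurable_walkFiltration (X : ℕ → Ω → ℤ) {m n : ℕ} (h : m ≤ n) :
    Measurable[walkFiltration X n] (X m) := by
  rw [measurable_iff_comap_le]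
  exact le_iSup₂_of_le (f := fun m _ => MeasurableSpace.comap (X m) inferInstance) m
    (Finset.mem_range.2 (by omega)) le_rfl

lemma walkFiltration_mono (X : ℕ → Ω → ℤ) {m n : ℕ} (h : m ≤ n) :
    walkFiltration X m ≤ walkFiltration X n :=
  iSup₂_le fun _ hi => measurable_iff_comap_le.1
    (measurable_walkFiltration X (by have := Finset.mem_range.1 hi; omega))

lemma measurableSet_right (X : ℕ → Ω → ℤ) (n : ℕ) :
    MeasurableSet[walkFiltration X (n + 1)] {ω | X (n + 1) ω = X n ω + 1} := by
  have h1 := measurable_walkFiltration X (le_refl (n + 1))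
  have h2 := measurable_walkFiltration X (Nat.le_succ n)
  exact @measurableSet_eq_fun _ _ (walkFiltration X (n + 1)) _ _ _ _ h1
    ((measurable_of_countable fun k : ℤ => k + 1).comp h2)

lemma measurableSet_pathWord_walkFiltration (X : ℕ → Ω → ℤ) (n : ℕ) (w : List Bool) :
    MeasurableSet[walkFiltration X n] {ω | pathWord X n ω = w} := by
  induction n generalizing w with
  | zero => exact @MeasurableSet.const _ (walkFiltration X 0) ([] = w)
  | succ n ih =>
    cases w with
    | nil => simp [pathWord]
    | cons r w =>
      have h1 := walkFiltration_mono X (Nat.le_succ n) _ (ih w)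
      have h2 := measurableSet_right X n
      cases r
      · convert h2.compl.inter h1 using 1
        ext ω; simp [pathWord]
      · convert h2.inter h1 using 1
        ext ω; simp [pathWord]

variable [MeasurableSpace Ω] {X : ℕ → Ω → ℤ}

lemma walkFiltration_le (hmeas : ∀ n, Measurable (X n)) (n : ℕ) :
    walkFiltration X n ≤ ‹MeasurableSpace Ω› :=
  iSup₂_le fun i _ => measurable_iff_comap_le.1 (hmeas i)

lemma measurableSet_pathWord (hmeas : ∀ n, Measurable (X n)) (n : ℕ) (w : List Bool) :
    MeasurableSet {ω | pathWord X n ω = w} :=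
  walkFiltration_le hmeas n _ (measurableSet_pathWord_walkFiltration X n w)

lemma measurableSet_pathWord_pred (hmeas : ∀ n, Measurable (X n)) (n : ℕ)
    (p : List Bool → Prop) : MeasurableSet {ω | p (pathWord X n ω)} := by
  have : {ω | p (pathWord X n ω)} = ⋃ w ∈ {w | p w}, {ω | pathWord X n ω = w} := by
    ext ω; simp
  rw [this]
  exact MeasurableSet.biUnion (Set.to_countable _) fun w _ => measurableSet_pathWord hmeas n w

variable {μ : Measure Ω}

lemma lintegral_pathWord_eq_tsum (hmeas : ∀ n, Measurable (X n)) (n : ℕ)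
    (G : List Bool → ENNReal) :
    ∫⁻ ω, G (pathWord X n ω) ∂μ = ∑' w, G w * μ {ω | pathWord X n ω = w} := by
  have hU : (⋃ w, {ω | pathWord X n ω = w}) = univ := by ext ω; simp
  rw [← setLIntegral_univ, ← hU, lintegral_iUnion (measurableSet_pathWord hmeas n)]
  · congr 1
    ext w
    rw [← setLIntegral_const]
    apply setLIntegral_congr_fun (measurableSet_pathWord hmeas n w)
    intro ω hω
    simp only [show pathWord X n ω = w from hω]
  · intro w w' hww
    exact Set.disjoint_left.2 fun ω h h' => hww (h.symm.trans h')

/-- The walk driven by `-Δ / 2`. -/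
structure IsDriven (μ : Measure Ω) (X : ℕ → Ω → ℤ) : Prop where
  meas : ∀ n, Measurable (X n)
  zero : ∀ᵐ ω ∂μ, X 0 ω = 0
  step : ∀ n, ∀ᵐ ω ∂μ, |X (n + 1) ω - X n ω| = 1
  drive : ∀ n,
    μ[(fun ω => if X (n + 1) ω = X n ω + 1 then (1 : ℝ) else 0) | walkFiltration X n]
      =ᵐ[μ] fun ω => walkF (-(Δ X n ω) / 2)

variable [IsProbabilityMeasure μ]

lemma measure_pathWord_cons (hX : IsDriven μ X) (n : ℕ) (w : List Bool) (r : Bool) :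
    μ {ω | pathWord X (n + 1) ω = r :: w}
      = ENNReal.ofReal (fermi (wordCost w r)) * μ {ω | pathWord X n ω = w} := by
  have hle := walkFiltration_le hX.meas
  set S := {ω | pathWord X n ω = w} with hS
  set T := {ω | X (n + 1) ω = X n ω + 1} with hT
  have hSm := measurableSet_pathWord hX.meas n w
  have hTm : MeasurableSet T := hle _ _ (measurableSet_right X n)
  have hf : (fun ω => if X (n + 1) ω = X n ω + 1 then (1 : ℝ) else 0) = T.indicator 1 := by
    ext ω; simp [indicator, hT]
  have hTint : Integrable (T.indicator (1 : Ω → ℝ)) μ :=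
    (integrable_const (1 : ℝ)).indicator hTm
  have h1 := setIntegral_condExp (hle n) hTint (measurableSet_pathWord_walkFiltration X n w)
  have h2 : ∫ ω in S, (μ[T.indicator (1 : Ω → ℝ) | walkFiltration X n]) ω ∂μ
      = ∫ _ in S, fermi (wordCost w true) ∂μ := by
    apply setIntegral_congr_ae hSm
    have hd := hX.drive n
    rw [hf] at hd
    filter_upwards [hd, hX.zero, ae_all_iff.2 hX.step] with ω h h0 hs hω
    rw [h, walkF_delta_eq h0 hs, show pathWord X n ω = w from hω]
  rw [h2, setIntegral_indicator hTm] at h1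
  simp only [integral_const, MeasurableSet.univ, Pi.one_apply, smul_eq_mul, mul_one,
    measureReal_restrict_apply, univ_inter] at h1
  have htrue : μ (S ∩ T) = ENNReal.ofReal (fermi (wordCost w true)) * μ S := by
    rw [← ofReal_measureReal, ← h1, ENNReal.ofReal_mul measureReal_nonneg, ofReal_measureReal,
      mul_comm]
  cases r
  · have hset : {ω | pathWord X (n + 1) ω = false :: w} = S \ T := by
      ext ω; simp [pathWord, hS, hT, and_comm]
    have h3 : (wordCost w true : ℝ) = -(wordCost w false : ℝ) := by simp [wordCost]
    have h4 : μ S = μ (S ∩ T) + μ (S \ T) := (measure_inter_add_sdiff S hTm).symm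
    have h5 : ENNReal.ofReal (fermi (wordCost w true)) + ENNReal.ofReal (fermi (wordCost w false))
        = 1 := by
      rw [← ENNReal.ofReal_add (fermi_pos _).le (fermi_pos _).le, h3, fermi_neg]
      simp
    rw [hset]
    have h6 : μ (S ∩ T) + μ (S \ T)
        = μ (S ∩ T) + ENNReal.ofReal (fermi (wordCost w false)) * μ S := by
      rw [← h4, htrue, ← add_mul, h5, one_mul]
    exact (ENNReal.add_right_inj (measure_ne_top μ _)).1 h6
  · rw [← htrue]
    congr 1
    ext ω; simp [pathWord, hS, hT, and_comm]

lemma lintegral_pathWord_succ (hX : IsDriven μ X) (n : ℕ) (G : List Bool → ENNReal) :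
    ∫⁻ ω, G (pathWord X (n + 1) ω) ∂μ = ∫⁻ ω,
      (ENNReal.ofReal (fermi (wordCost (pathWord X n ω) false)) * G (false :: pathWord X n ω) +
      ENNReal.ofReal (fermi (wordCost (pathWord X n ω) true)) * G (true :: pathWord X n ω)) ∂μ := by
  rw [lintegral_pathWord_eq_tsum hX.meas n (fun w =>
      ENNReal.ofReal (fermi (wordCost w false)) * G (false :: w) +
      ENNReal.ofReal (fermi (wordCost w true)) * G (true :: w)),
    lintegral_pathWord_eq_tsum hX.meas (n + 1) G]
  have hinj : Function.Injective (fun p : Bool × List Bool => p.1 :: p.2) := by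
    rintro ⟨a, b⟩ ⟨c, d⟩ h; simpa using h
  rw [← hinj.tsum_eq]
  · rw [ENNReal.tsum_prod (f := fun r w => G (r :: w) * μ {ω | pathWord X (n + 1) ω = r :: w}),
      tsum_bool, ← ENNReal.tsum_add]
    congr 1
    ext w
    rw [measure_pathWord_cons hX, measure_pathWord_cons hX]
    ring
  · intro w hw
    cases w with
    | nil => simp [pathWord] at hw
    | cons r w => exact ⟨(r, w), rfl⟩

lemma measure_pathWord_pos (hX : IsDriven μ X) (w : List Bool) :
    0 < μ {ω | pathWord X w.length ω = w} := by
  induction w with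
  | nil => simp [pathWord]
  | cons r w ih =>
    rw [List.length_cons, measure_pathWord_cons hX]
    exact ENNReal.mul_pos (ENNReal.ofReal_pos.2 (fermi_pos _)).ne' ih.ne'

end Walk

namespace FrontState

lemma fermi_nonneg (s : ℝ) : 0 ≤ fermi s := (fermi_pos s).le

lemma comp_nonneg (t : FrontState) : 0 ≤ t.comp :=
  add_nonneg (fermi_nonneg _) (fermi_nonneg _)

lemma comp_le_two (t : FrontState) : t.comp ≤ 2 := by
  unfold comp
  linarith [fermi_le_one t.nextDrift, fermi_le_one (t.c - t.b)]

lemma sq_length_le {t : FrontState} {w : List Bool} (hi : t.Inv) (hd : t.Describes w) :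
    (w.length : ℝ) ^ 2 ≤ 4 * (t.M : ℝ) ^ 4 := by
  have h1 := time_le hi
  have h2 : (w.length : ℝ) = t.time := by exact_mod_cast hd.length_eq
  have h3 : (0 : ℝ) ≤ w.length := by positivity
  rw [h2] at h3 ⊢
  nlinarith

lemma exp_neg_threshold_le {t : FrontState} {w : List Bool} (hi : t.Inv) (hd : t.Describes w)
    (hw : 0 < w.length) : exp (-t.threshold) ≤ 4 / (w.length : ℝ) ^ 2 := by
  have h := sq_length_le hi hd
  have hw' : (0 : ℝ) < w.length := by exact_mod_cast hw
  have hM : (0 : ℝ) < t.M := by linarith [hi.four_million_le]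
  rw [exp_neg_threshold hi.four_million_le, ← one_div, div_le_div_iff₀ (by positivity)
    (by positivity)]
  linarith

/-- A deviation by `ε M` at time `n` has at most a probability of order this constant over
`n ^ 2`. -/
def deviationConst (ε : ℝ) : ℝ := 96 / (ε ^ 2 / 32) ^ 4

lemma one_le_weight_add_weight {t : FrontState} {w : List Bool} (hi : t.Inv) (hd : t.Describes w)
    (hw : 0 < w.length) {ε : ℝ} (hε : 0 < ε) (h : ε * t.M < |t.pred - t.M|) :
    1 ≤ deviationConst ε / (w.length : ℝ) ^ 2 * (weight (ε / 16) t + weight (-(ε / 16)) t) := by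
  have h1 := sq_length_le hi hd
  have hw' : (0 : ℝ) < w.length := by exact_mod_cast hw
  have hM : (0 : ℝ) < t.M := by linarith [hi.four_million_le]
  have h2 := pow_div_factorial_le_exp (ε ^ 2 / 32 * t.M) (by positivity) 4
  have h3 : exp (ε ^ 2 / 32 * t.M) ≤ weight (ε / 16) t + weight (-(ε / 16)) t := by
    have hc := comp_nonneg t
    have hc' : 0 ≤ ε ^ 2 * t.comp := by positivity
    rcases lt_abs.1 h with h4 | h4
    · have : exp (ε ^ 2 / 32 * t.M) ≤ weight (ε / 16) t := exp_le_exp.2 (by nlinarith)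
      have : 0 ≤ weight (-(ε / 16)) t := (exp_pos _).le
      linarith
    · have : exp (ε ^ 2 / 32 * t.M) ≤ weight (-(ε / 16)) t := exp_le_exp.2 (by nlinarith)
      have : 0 ≤ weight (ε / 16) t := (exp_pos _).le
      linarith
  refine le_trans ?_ (mul_le_mul_of_nonneg_left (h2.trans h3) (by unfold deviationConst; positivity))
  unfold deviationConst
  rw [mul_pow, show ((Nat.factorial 4 : ℕ) : ℝ) = 24 by norm_num [Nat.factorial]]
  have hk : 0 < (ε ^ 2 / 32) ^ 4 := by positivity
  generalize (ε ^ 2 / 32) ^ 4 = k at hk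
  have : 96 / k / (w.length : ℝ) ^ 2 * (k * (t.M : ℝ) ^ 4 / 24)
      = 4 * (t.M : ℝ) ^ 4 / (w.length : ℝ) ^ 2 := by
    field_simp; norm_num
  rw [this, le_div_iff₀ (by positivity)]
  linarith

/-- The weight of a possibly lost front state. -/
def optWeight (l : ℝ) : Option FrontState → ENNReal
  | none => 0
  | some t => ENNReal.ofReal (weight l t)

lemma weight_pos (l : ℝ) (t : FrontState) : 0 < weight l t := exp_pos _

lemma optWeight_step {A : List Bool} {t₀ : FrontState} (hd : t₀.Describes A) (hi : t₀.Inv)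
    {l : ℝ} (hl : |l| ≤ 1 / 2) (m : ℕ) (w : List Bool) (hw : 0 < w.length) :
    ENNReal.ofReal (fermi (wordCost w false)) * optWeight l (trajectory A t₀ (m + 1) (false :: w)) +
      ENNReal.ofReal (fermi (wordCost w true)) * optWeight l (trajectory A t₀ (m + 1) (true :: w))
    ≤ ENNReal.ofReal (1 + 24 / (w.length : ℝ) ^ 2) * optWeight l (trajectory A t₀ m w) := by
  classical
  simp only [trajectory]
  cases h : trajectory A t₀ m w with
  | none => simp [step, optWeight]
  | some t =>
    obtain ⟨i, d⟩ := trajectory_spec hd hi h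
    by_cases hb : t.Balanced
    · have key := weight_step i hb hl
      have hexp := exp_neg_threshold_le i d hw
      have e : ∀ r, optWeight l (step (some t) r)
          = ENNReal.ofReal (if t.Rare r then 0 else weight l (t.next r)) := fun r => by
        by_cases hr : t.Rare r <;> simp [step, hb, hr, optWeight]
      have hpos : ∀ r, 0 ≤ (if t.Rare r then 0 else weight l (t.next r)) := fun r => by
        split_ifs
        · exact le_rfl
        · exact (exp_pos _).le
      have hwt : 0 ≤ weight l t := (exp_pos _).le
      rw [e, e, d.wordCost_eq, d.wordCost_eq, optWeight, ← ENNReal.ofReal_mul (fermi_nonneg _),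
        ← ENNReal.ofReal_mul (fermi_nonneg _), ← ENNReal.ofReal_mul (by positivity),
        ← ENNReal.ofReal_add (mul_nonneg (fermi_nonneg _) (hpos _))
          (mul_nonneg (fermi_nonneg _) (hpos _))]
      refine ENNReal.ofReal_le_ofReal (key.trans (mul_le_mul_of_nonneg_right ?_ hwt))
      rw [show (24 : ℝ) / (w.length : ℝ) ^ 2 = 6 * (4 / (w.length : ℝ) ^ 2) by ring]
      linarith
    · simp [step, hb, optWeight]

lemma optWeight_initial_le {t₀ : FrontState} (hi : t₀.Inv) (hp : |t₀.pred - t₀.M| ≤ 9)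
    {l : ℝ} (hl : |l| ≤ 1 / 2) : weight l t₀ ≤ exp 5 := by
  unfold weight
  refine exp_le_exp.2 ?_
  have h1 : l * (t₀.pred - t₀.M) ≤ 1 / 2 * 9 :=
    (le_abs_self _).trans (by rw [abs_mul]; gcongr)
  have h2 : 8 * l ^ 2 * (t₀.comp - t₀.M) ≤ 0 :=
    mul_nonpos_of_nonneg_of_nonpos (by positivity)
      (by linarith [comp_le_two t₀, hi.four_million_le])
  linarith

lemma inv_sq_le_sub {n : ℝ} (hn : 1 < n) : 1 / n ^ 2 ≤ 1 / (n - 1) - 1 / n := by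
  have h : 0 < n - 1 := by linarith
  have h' : 0 < n := by linarith
  rw [div_sub_div _ _ h.ne' h'.ne', div_le_div_iff₀ (by positivity) (by positivity)]
  nlinarith

open Classical in
lemma loss_step (hd : t₀.Describes A) (hi : t₀.Inv) (m : ℕ) (w : List Bool) (hw : 0 < w.length) :
    ENNReal.ofReal (fermi (wordCost w false)) *
        (if trajectory A t₀ m w ≠ none ∧ step (trajectory A t₀ m w) false = none then 1 else 0) +
      ENNReal.ofReal (fermi (wordCost w true)) *
        (if trajectory A t₀ m w ≠ none ∧ step (trajectory A t₀ m w) true = none then 1 else 0)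
    ≤ (if ∃ t, trajectory A t₀ m w = some t ∧ 1 / 10 * (t.M : ℝ) < |t.pred - t.M| then 1 else 0) +
      ENNReal.ofReal (8 / (w.length : ℝ) ^ 2) *
        (if trajectory A t₀ m w ≠ none then 1 else 0) := by
  cases h : trajectory A t₀ m w with
  | none => simp
  | some t =>
    obtain ⟨i, d⟩ := trajectory_spec hd hi h
    have hexp := exp_neg_threshold_le i d hw
    by_cases hb : t.Balanced
    · have e : ∀ r, ENNReal.ofReal (fermi (wordCost w r)) *
          (if some t ≠ none ∧ step (some t) r = none then 1 else 0)
          ≤ ENNReal.ofReal (4 / (w.length : ℝ) ^ 2) := fun r => by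
        by_cases hr : t.Rare r
        · rw [d.wordCost_eq, if_pos (by simp [step, hr]), mul_one]
          refine ENNReal.ofReal_le_ofReal ((fermi_le_exp _).trans (le_trans ?_ hexp))
          exact exp_le_exp.2 (neg_le_neg hr)
        · simp [step, hr, hb]
      refine le_add_left ((add_le_add (e false) (e true)).trans ?_)
      rw [← ENNReal.ofReal_add (by positivity) (by positivity), if_pos (by simp), mul_one]
      exact ENNReal.ofReal_le_ofReal (le_of_eq (by ring))
    · refine le_add_right ?_
      have hb' : 1 / 10 * (t.M : ℝ) < |t.pred - t.M| := by
        have := not_le.1 hb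
        linarith
      rw [if_pos (by simp [step, hb]), if_pos (by simp [step, hb]), if_pos ⟨t, rfl, hb'⟩, mul_one,
        mul_one, ← ENNReal.ofReal_add (fermi_nonneg _) (fermi_nonneg _)]
      have h3 : (wordCost w true : ℝ) = -(wordCost w false : ℝ) := by simp [wordCost]
      rw [h3, fermi_neg]
      simp

section Probability

variable {Ω : Type*} {X : ℕ → Ω → ℤ} {A : List Bool} {t₀ : FrontState}

/-- The front state of the walk `m` steps after it has followed the word `A`. -/
def frontAt (A : List Bool) (t₀ : FrontState) (X : ℕ → Ω → ℤ) (m : ℕ) (ω : Ω) :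
    Option FrontState :=
  trajectory A t₀ m (pathWord X (A.length + m) ω)

/-- The event that the front state deviates from the diagonal. -/
def deviation (A : List Bool) (t₀ : FrontState) (X : ℕ → Ω → ℤ) (ε : ℝ) (m : ℕ) : Set Ω :=
  {ω | ∃ t, frontAt A t₀ X m ω = some t ∧ ε * t.M < |t.pred - t.M|}

/-- The event that the front state is lost. -/
def lost (A : List Bool) (t₀ : FrontState) (X : ℕ → Ω → ℤ) (m : ℕ) : Set Ω :=
  {ω | frontAt A t₀ X m ω ≠ none ∧ frontAt A t₀ X (m + 1) ω = none}

lemma frontAt_zero_ne_none (ω : Ω) :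
    frontAt A t₀ X 0 ω ≠ none ↔ pathWord X A.length ω = A := by
  simp [frontAt, trajectory]

lemma frontAt_succ (m : ℕ) (ω : Ω) :
    frontAt A t₀ X (m + 1) ω = step (frontAt A t₀ X m ω)
      (decide (X (A.length + m + 1) ω = X (A.length + m) ω + 1)) := rfl

lemma frontAt_ne_none_zero {m : ℕ} {ω : Ω} (h : frontAt A t₀ X m ω ≠ none) :
    pathWord X A.length ω = A := by
  rw [← frontAt_zero_ne_none (t₀ := t₀)]
  induction m with
  | zero => exact h
  | succ m ih =>
    refine ih fun h' => h ?_
    rw [frontAt_succ, h', step]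

variable [MeasurableSpace Ω] {μ : Measure Ω}

lemma measurable_pathWord_comp (hmeas : ∀ n, Measurable (X n)) (n : ℕ) (G : List Bool → ENNReal) :
    Measurable fun ω => G (pathWord X n ω) :=
  fun s _ => measurableSet_pathWord_pred hmeas n fun w => G w ∈ s

lemma measurableSet_deviation (hmeas : ∀ n, Measurable (X n)) (ε : ℝ) (m : ℕ) :
    MeasurableSet (deviation A t₀ X ε m) :=
  measurableSet_pathWord_pred hmeas (A.length + m) fun w =>
    ∃ t, trajectory A t₀ m w = some t ∧ ε * t.M < |t.pred - t.M|

variable [IsProbabilityMeasure μ]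

lemma lintegral_optWeight_le (hX : IsDriven μ X) (hd : t₀.Describes A) (hi : t₀.Inv)
    (hp : |t₀.pred - t₀.M| ≤ 9) (hA : 2 ≤ A.length) {l : ℝ} (hl : |l| ≤ 1 / 2) (m : ℕ) :
    ∫⁻ ω, optWeight l (frontAt A t₀ X m ω) ∂μ
      ≤ ENNReal.ofReal (exp 29) * μ {ω | pathWord X A.length ω = A} := by
  have hA' : (2 : ℝ) ≤ A.length := by exact_mod_cast hA
  have h0 : ∫⁻ ω, optWeight l (frontAt A t₀ X 0 ω) ∂μ
      ≤ ENNReal.ofReal (exp 5) * μ {ω | pathWord X A.length ω = A} := by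
    rw [← lintegral_indicator_const (measurableSet_pathWord hX.meas _ _)]
    refine lintegral_mono fun ω => ?_
    by_cases h : pathWord X A.length ω = A
    · simp only [frontAt, trajectory, add_zero, h, if_true, optWeight, indicator, mem_ofPred_eq]
      exact ENNReal.ofReal_le_ofReal (optWeight_initial_le hi hp hl)
    · simp [frontAt, trajectory, h, optWeight]
  have h1 : ∫⁻ ω, optWeight l (frontAt A t₀ X m ω) ∂μ
      ≤ ENNReal.ofReal (exp (24 * (1 / ((A.length : ℝ) - 1) - 1 / ((A.length : ℝ) + m - 1))))
        * (ENNReal.ofReal (exp 5) * μ {ω | pathWord X A.length ω = A}) := by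
    induction m with
    | zero => simpa using h0
    | succ m ih =>
      have hn : (1 : ℝ) < A.length + m := by
        have : (0 : ℝ) ≤ m := by positivity
        linarith
      calc ∫⁻ ω, optWeight l (frontAt A t₀ X (m + 1) ω) ∂μ
          ≤ ∫⁻ ω, ENNReal.ofReal (1 + 24 / ((A.length : ℝ) + m) ^ 2) *
              optWeight l (frontAt A t₀ X m ω) ∂μ := by
            have := lintegral_pathWord_succ hX (A.length + m)
              fun w => optWeight l (trajectory A t₀ (m + 1) w)
            refine this.trans_le (lintegral_mono fun ω => ?_)
            have h := optWeight_step hd hi hl m (pathWord X (A.length + m) ω)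
              (by rw [length_pathWord]; omega)
            rw [length_pathWord] at h
            push_cast at h
            exact h
        _ = ENNReal.ofReal (1 + 24 / ((A.length : ℝ) + m) ^ 2) *
              ∫⁻ ω, optWeight l (frontAt A t₀ X m ω) ∂μ :=
            lintegral_const_mul' _ _ ENNReal.ofReal_ne_top
        _ ≤ _ := by
            refine (mul_le_mul_right ih _).trans ?_
            rw [← mul_assoc, ← ENNReal.ofReal_mul (by positivity)]
            refine mul_le_mul_left (ENNReal.ofReal_le_ofReal ?_) _
            have h2 := inv_sq_le_sub hn
            have h3 := add_one_le_exp (24 / ((A.length : ℝ) + m) ^ 2)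
            refine (mul_le_mul_of_nonneg_right ((add_comm _ _).trans_le h3) (exp_pos _).le).trans ?_
            rw [← exp_add]
            refine exp_le_exp.2 ?_
            push_cast
            rw [show (A.length : ℝ) + (m + 1) - 1 = A.length + m by ring,
              show (24 : ℝ) / ((A.length : ℝ) + m) ^ 2 = 24 * (1 / ((A.length : ℝ) + m) ^ 2) by ring]
            linarith
  refine h1.trans ?_
  rw [← mul_assoc, ← ENNReal.ofReal_mul (exp_pos _).le, ← exp_add]
  refine mul_le_mul_left (ENNReal.ofReal_le_ofReal (exp_le_exp.2 ?_)) _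
  have h2 : 1 / ((A.length : ℝ) - 1) ≤ 1 := by
    rw [div_le_one (by linarith)]; linarith
  have h3 : 0 ≤ 1 / ((A.length : ℝ) + m - 1) := by
    apply div_nonneg zero_le_one
    have : (0 : ℝ) ≤ m := by positivity
    linarith
  linarith

lemma measure_deviation_le (hX : IsDriven μ X) (hd : t₀.Describes A) (hi : t₀.Inv)
    (hp : |t₀.pred - t₀.M| ≤ 9) (hA : 2 ≤ A.length) {ε : ℝ} (hε : 0 < ε) (hε1 : ε ≤ 1) (m : ℕ) :
    μ (deviation A t₀ X ε m) ≤
      ENNReal.ofReal (deviationConst ε * (2 * exp 29) / ((A.length : ℝ) + m) ^ 2) *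
        μ {ω | pathWord X A.length ω = A} := by
  have hK : 0 ≤ deviationConst ε / ((A.length : ℝ) + m) ^ 2 := by
    unfold deviationConst; positivity
  calc μ (deviation A t₀ X ε m)
      = ∫⁻ ω, (deviation A t₀ X ε m).indicator 1 ω ∂μ :=
        (lintegral_indicator_one (measurableSet_deviation hX.meas ε m)).symm
    _ ≤ ∫⁻ ω, ENNReal.ofReal (deviationConst ε / ((A.length : ℝ) + m) ^ 2) *
          (optWeight (ε / 16) (frontAt A t₀ X m ω) +
            optWeight (-(ε / 16)) (frontAt A t₀ X m ω)) ∂μ := by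
        refine lintegral_mono fun ω => ?_
        by_cases h : ω ∈ deviation A t₀ X ε m
        · rw [indicator_of_mem h]
          obtain ⟨t, h1, h2⟩ := h
          obtain ⟨i, d⟩ := trajectory_spec hd hi h1
          have := one_le_weight_add_weight i d (by rw [length_pathWord]; omega) hε h2
          rw [length_pathWord] at this
          push_cast at this
          rw [h1, optWeight, optWeight, ← ENNReal.ofReal_add (weight_pos _ _).le (weight_pos _ _).le,
            ← ENNReal.ofReal_mul hK, Pi.one_apply, ENNReal.one_le_ofReal]
          exact this
        · rw [indicator_of_notMem h]
          exact zero_le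
    _ = ENNReal.ofReal (deviationConst ε / ((A.length : ℝ) + m) ^ 2) *
          (∫⁻ ω, optWeight (ε / 16) (frontAt A t₀ X m ω) ∂μ +
            ∫⁻ ω, optWeight (-(ε / 16)) (frontAt A t₀ X m ω) ∂μ) := by
        rw [lintegral_const_mul' _ _ ENNReal.ofReal_ne_top]
        congr 1
        exact lintegral_add_left (measurable_pathWord_comp hX.meas _
          fun w => optWeight (ε / 16) (trajectory A t₀ m w)) _
    _ ≤ ENNReal.ofReal (deviationConst ε / ((A.length : ℝ) + m) ^ 2) *
          (ENNReal.ofReal (exp 29) * μ {ω | pathWord X A.length ω = A} +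
            ENNReal.ofReal (exp 29) * μ {ω | pathWord X A.length ω = A}) := by
        have hl : |ε / 16| ≤ 1 / 2 := by rw [abs_of_pos (by positivity)]; linarith
        gcongr
        · exact lintegral_optWeight_le hX hd hi hp hA hl m
        · exact lintegral_optWeight_le hX hd hi hp hA (by rwa [abs_neg]) m
    _ = _ := by
        rw [← add_mul, ← ENNReal.ofReal_add (exp_pos _).le (exp_pos _).le, ← mul_assoc,
          ← ENNReal.ofReal_mul hK]
        congr 2
        ring

lemma measure_lost_le (hX : IsDriven μ X) (hd : t₀.Describes A) (hi : t₀.Inv)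
    (hp : |t₀.pred - t₀.M| ≤ 9) (hA : 2 ≤ A.length) (m : ℕ) :
    μ (lost A t₀ X m) ≤
      ENNReal.ofReal ((deviationConst (1 / 10) * (2 * exp 29) + 8) / ((A.length : ℝ) + m) ^ 2) *
        μ {ω | pathWord X A.length ω = A} := by
  classical
  have hlost : MeasurableSet (lost A t₀ X m) :=
    measurableSet_pathWord_pred hX.meas (A.length + (m + 1)) fun w =>
      trajectory A t₀ m w.tail ≠ none ∧ trajectory A t₀ (m + 1) w = none
  have halive : MeasurableSet {ω | frontAt A t₀ X m ω ≠ none} :=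
    measurableSet_pathWord_pred hX.meas (A.length + m) fun w => trajectory A t₀ m w ≠ none
  calc μ (lost A t₀ X m)
      = ∫⁻ ω, (fun w => if trajectory A t₀ m w.tail ≠ none ∧ trajectory A t₀ (m + 1) w = none
          then 1 else 0) (pathWord X (A.length + m + 1) ω) ∂μ := by
        rw [← lintegral_indicator_one hlost]
        refine lintegral_congr fun ω => ?_
        by_cases h : ω ∈ lost A t₀ X m
        · rw [indicator_of_mem h]
          exact (if_pos h).symm
        · rw [indicator_of_notMem h]
          exact (if_neg h).symm
    _ ≤ ∫⁻ ω, ((deviation A t₀ X (1 / 10) m).indicator 1 ω +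
          ENNReal.ofReal (8 / ((A.length : ℝ) + m) ^ 2) *
            {ω | frontAt A t₀ X m ω ≠ none}.indicator 1 ω) ∂μ := by
        refine (lintegral_pathWord_succ hX (A.length + m) fun w =>
          if trajectory A t₀ m w.tail ≠ none ∧ trajectory A t₀ (m + 1) w = none
          then 1 else 0).trans_le (lintegral_mono fun ω => ?_)
        have h := loss_step hd hi m (pathWord X (A.length + m) ω)
          (by rw [length_pathWord]; omega)
        rw [length_pathWord] at h
        push_cast at h
        refine h.trans (le_of_eq ?_)
        congr 1
        · by_cases h : ω ∈ deviation A t₀ X (1 / 10) m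
          · rw [indicator_of_mem h]
            exact if_pos h
          · rw [indicator_of_notMem h]
            exact if_neg h
        · congr 1
          by_cases h : ω ∈ {ω | frontAt A t₀ X m ω ≠ none}
          · rw [indicator_of_mem h]
            exact if_pos h
          · rw [indicator_of_notMem h]
            exact if_neg h
    _ = μ (deviation A t₀ X (1 / 10) m) + ENNReal.ofReal (8 / ((A.length : ℝ) + m) ^ 2) *
          μ {ω | frontAt A t₀ X m ω ≠ none} := by
        have hdev := measurableSet_deviation (A := A) (t₀ := t₀) hX.meas (1 / 10) m
        rw [lintegral_add_left (measurable_one.indicator hdev),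
          lintegral_const_mul' _ _ ENNReal.ofReal_ne_top, lintegral_indicator_one hdev,
          lintegral_indicator_one halive]
    _ ≤ ENNReal.ofReal (deviationConst (1 / 10) * (2 * exp 29) / ((A.length : ℝ) + m) ^ 2) *
          μ {ω | pathWord X A.length ω = A} + ENNReal.ofReal (8 / ((A.length : ℝ) + m) ^ 2) *
          μ {ω | pathWord X A.length ω = A} := by
        refine add_le_add ?_ (mul_le_mul_right (measure_mono ?_) _)
        · exact measure_deviation_le hX hd hi hp hA (by norm_num) (by norm_num) m
        · exact fun ω hω => frontAt_ne_none_zero hω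
    _ = _ := by
        rw [← add_mul, ← ENNReal.ofReal_add (by unfold deviationConst; positivity) (by positivity),
          ← add_div]

lemma tsum_ofReal_div_sq_le {C N : ℝ} (hC : 0 ≤ C) (hN : 1 < N) :
    ∑' m : ℕ, ENNReal.ofReal (C / (N + m) ^ 2) ≤ ENNReal.ofReal (C / (N - 1)) := by
  refine ENNReal.tsum_le_of_sum_range_le fun k => ?_
  have h : ∑ m ∈ Finset.range k, C / (N + m) ^ 2 ≤ C * (1 / (N - 1) - 1 / (N + k - 1)) := by
    induction k with
    | zero => simp
    | succ k ih =>
      have hk : (0 : ℝ) ≤ k := by positivity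
      rw [Finset.sum_range_succ]
      have := mul_le_mul_of_nonneg_left (inv_sq_le_sub (n := N + k) (by linarith)) hC
      push_cast
      rw [show N + ((k : ℝ) + 1) - 1 = N + k by ring, div_eq_mul_one_div C]
      linarith
  rw [← ENNReal.ofReal_sum_of_nonneg fun _ _ => by positivity]
  refine ENNReal.ofReal_le_ofReal (h.trans ?_)
  have hk : (0 : ℝ) ≤ k := by positivity
  have : 0 ≤ C * (1 / (N + k - 1)) :=
    mul_nonneg hC (div_nonneg zero_le_one (by linarith))
  rw [div_eq_mul_one_div C]
  linarith

lemma measure_alive_pos (hX : IsDriven μ X) (hd : t₀.Describes A) (hi : t₀.Inv)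
    (hp : |t₀.pred - t₀.M| ≤ 9) (hA : 2 ≤ A.length)
    (hlarge : deviationConst (1 / 10) * (2 * exp 29) + 8 < A.length - 1) :
    0 < μ {ω | ∀ m, frontAt A t₀ X m ω ≠ none} := by
  have hA' : (2 : ℝ) ≤ A.length := by exact_mod_cast hA
  have hpos := measure_pathWord_pos hX A
  have hsub : {ω | pathWord X A.length ω = A} ⊆
      {ω | ∀ m, frontAt A t₀ X m ω ≠ none} ∪ ⋃ m, lost A t₀ X m := by
    intro ω hω
    by_contra h
    simp only [mem_union, mem_ofPred_eq, mem_iUnion, not_or, lost, not_exists, not_and] at h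
    refine h.1 fun m => ?_
    induction m with
    | zero => exact (frontAt_zero_ne_none ω).2 hω
    | succ m ih => exact h.2 m ih
  by_contra hzero
  have hzero' := nonpos_iff_eq_zero.1 (not_lt.1 hzero)
  have h1 : μ {ω | pathWord X A.length ω = A} ≤
      ENNReal.ofReal ((deviationConst (1 / 10) * (2 * exp 29) + 8) / ((A.length : ℝ) - 1)) *
        μ {ω | pathWord X A.length ω = A} := by
    refine (measure_mono hsub).trans ((measure_union_le _ _).trans ?_)
    rw [hzero', zero_add]
    refine (measure_iUnion_le _).trans ((ENNReal.tsum_le_tsum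
      fun m => measure_lost_le hX hd hi hp hA m).trans ?_)
    rw [ENNReal.tsum_mul_right]
    exact mul_le_mul_left (tsum_ofReal_div_sq_le (by unfold deviationConst; positivity)
      (by linarith)) _
  refine absurd h1 (not_le.2 ?_)
  have h2 : ENNReal.ofReal ((deviationConst (1 / 10) * (2 * exp 29) + 8) / ((A.length : ℝ) - 1))
      < 1 := by
    rw [ENNReal.ofReal_lt_one, div_lt_one (by linarith)]
    exact hlarge
  calc _ < 1 * μ {ω | pathWord X A.length ω = A} :=
        (ENNReal.mul_lt_mul_iff_left hpos.ne' (measure_ne_top _ _)).2 h2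
    _ = _ := one_mul _

lemma ae_eventually_notMem_deviation (hX : IsDriven μ X) (hd : t₀.Describes A) (hi : t₀.Inv)
    (hp : |t₀.pred - t₀.M| ≤ 9) (hA : 2 ≤ A.length) :
    ∀ᵐ ω ∂μ, ∀ j : ℕ, ∀ᶠ m in atTop, ω ∉ deviation A t₀ X (1 / ((j : ℝ) + 1)) m := by
  rw [ae_all_iff]
  intro j
  have hA' : (2 : ℝ) ≤ A.length := by exact_mod_cast hA
  have hj : (0 : ℝ) < (j : ℝ) + 1 := by positivity
  refine ae_eventually_notMem (ne_top_of_le_ne_top ?_ (ENNReal.tsum_le_tsum fun m =>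
    measure_deviation_le hX hd hi hp hA (ε := 1 / ((j : ℝ) + 1)) (by positivity)
      (by rw [div_le_one hj]; linarith [Nat.cast_nonneg (α := ℝ) j]) m))
  rw [ENNReal.tsum_mul_right]
  refine ENNReal.mul_ne_top (ne_top_of_le_ne_top ENNReal.ofReal_ne_top
    (tsum_ofReal_div_sq_le ?_ (by linarith))) (measure_ne_top _ _)
  unfold deviationConst
  positivity

end Probability

end FrontState

namespace FrontState

lemma next_cases (t : FrontState) (r : Bool) :
    ((t.next r).M = t.M ∧ (t.next r).R = t.R) ∨
      ((t.next r).M = t.M + 1 ∧ (t.next r).R = t.R + t.b) := by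
  obtain ⟨p, M, a', a, b, c, R⟩ := t
  cases p <;> cases r <;> simp [next]

/-- A sequence of successive front states whose predictions concentrate. -/
structure Concentrated (t : ℕ → FrontState) : Prop where
  inv : ∀ m, (t m).Inv
  balanced : ∀ m, (t m).Balanced
  next_eq : ∀ m, ∃ r, t (m + 1) = (t m).next r
  le_time : ∀ m : ℕ, (m : ℤ) ≤ (t m).time
  eventually_le : ∀ j : ℕ, ∀ᶠ m in atTop,
    |(t m).pred - (t m).M| ≤ 1 / ((j : ℝ) + 1) * (t m).M

namespace Concentrated

variable {t : ℕ → FrontState}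

lemma M_pos (h : Concentrated t) (m : ℕ) : (0 : ℝ) < (t m).M := by
  linarith [(h.inv m).four_million_le]

lemma tendsto_M (h : Concentrated t) : Tendsto (fun m => ((t m).M : ℝ)) atTop atTop := by
  refine tendsto_atTop.2 fun K => ?_
  filter_upwards [eventually_ge_atTop ⌈2 * K ^ 2⌉₊] with m hm
  have h1 : 2 * K ^ 2 ≤ m := Nat.ceil_le.1 hm
  have h2 : (m : ℝ) ≤ (t m).time := by exact_mod_cast h.le_time m
  have h3 := time_le (h.inv m)
  exact le_of_sq_le_sq (by linarith) (h.M_pos m).le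

lemma tendsto_threshold_div (h : Concentrated t) :
    Tendsto (fun m => (t m).threshold / (t m).M) atTop (nhds 0) := by
  have h1 := (isLittleO_log_id_atTop.tendsto_div_nhds_zero.comp h.tendsto_M).const_mul 4
  rw [mul_zero] at h1
  refine h1.congr fun m => ?_
  simp only [threshold, Function.comp, id]
  ring

lemma tendsto_pred_sub_div (h : Concentrated t) :
    Tendsto (fun m => ((t m).pred - (t m).M) / (t m).M) atTop (nhds 0) := by
  rw [Metric.tendsto_atTop']
  intro ε hε
  obtain ⟨j, hj⟩ := exists_nat_one_div_lt hε
  obtain ⟨N, hN⟩ := eventually_atTop.1 (h.eventually_le j)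
  refine ⟨N, fun m hm => ?_⟩
  have hM := h.M_pos m
  rw [dist_zero_right, norm_eq_abs, abs_div, abs_of_pos hM]
  refine lt_of_le_of_lt ?_ hj
  rw [div_le_iff₀ hM]
  exact hN m hm.le

lemma tendsto_b_div (h : Concentrated t) :
    Tendsto (fun m => ((t m).b : ℝ) / (t m).M) atTop (nhds 1) := by
  have h0 : Tendsto (fun m => (10 : ℝ) / (t m).M) atTop (nhds 0) :=
    tendsto_const_nhds.div_atTop h.tendsto_M
  have hup : Tendsto (fun m => 1 + ((t m).pred - (t m).M) / (t m).M) atTop (nhds 1) := by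
    simpa using h.tendsto_pred_sub_div.const_add 1
  have hlow : Tendsto (fun m => 1 + ((t m).pred - (t m).M) / (t m).M
      - 2 * ((t m).threshold / (t m).M) - 10 / (t m).M) atTop (nhds 1) := by
    simpa using (hup.sub (h.tendsto_threshold_div.const_mul 2)).sub h0
  refine tendsto_of_tendsto_of_tendsto_of_le_of_le hlow hup (fun m => ?_) (fun m => ?_)
  · have hM := h.M_pos m
    have := pred_le (h.inv m)
    rw [← sub_nonneg, show ((t m).b : ℝ) / (t m).M - (1 + ((t m).pred - (t m).M) / (t m).M
      - 2 * ((t m).threshold / (t m).M) - 10 / (t m).M)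
      = ((t m).b + 2 * (t m).threshold + 10 - (t m).pred) / (t m).M by field_simp; ring]
    exact div_nonneg (by linarith) hM.le
  · have hM := h.M_pos m
    have := le_pred (t m)
    rw [← sub_nonneg, show 1 + ((t m).pred - (t m).M) / (t m).M - ((t m).b : ℝ) / (t m).M
      = ((t m).pred - (t m).b) / (t m).M by field_simp; ring]
    exact div_nonneg (by linarith) hM.le

lemma abs_R_sub_le (h : Concentrated t) {ε : ℝ} (hε : 0 < ε) :
    ∃ K : ℝ, ∀ᶠ m in atTop,
      |((t m).R : ℝ) - (t m).M ^ 2 / 2| ≤ K + ε * (t m).M ^ 2 + (t m).M / 2 := by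
  obtain ⟨N, hN⟩ := Metric.tendsto_atTop.1 h.tendsto_b_div ε hε
  refine ⟨|((t N).R : ℝ) - (t N).M ^ 2 / 2|, eventually_atTop.2 ⟨N, fun m hm => ?_⟩⟩
  induction m, hm using Nat.le_induction with
  | base =>
    have := h.M_pos N
    have : 0 ≤ ε * ((t N).M : ℝ) ^ 2 := by positivity
    linarith
  | succ m hm ih =>
    obtain ⟨r, hr⟩ := h.next_eq m
    have hM := h.M_pos m
    have hb : |((t m).b : ℝ) - (t m).M| ≤ ε * (t m).M := by
      have := (hN m hm).le
      rwa [dist_eq_norm, norm_eq_abs, div_sub_one hM.ne', abs_div, abs_of_pos hM,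
        div_le_iff₀ hM] at this
    rw [hr]
    rcases next_cases (t m) r with ⟨h1, h2⟩ | ⟨h1, h2⟩
    · rw [h1, h2]; exact ih
    · rw [h1, h2]
      push_cast
      rw [abs_le] at ih hb ⊢
      have := mul_pos hε hM
      constructor <;> nlinarith

lemma tendsto_R_div (h : Concentrated t) :
    Tendsto (fun m => ((t m).R : ℝ) / (t m).M ^ 2) atTop (nhds (1 / 2)) := by
  rw [Metric.tendsto_nhds]
  intro ε hε
  obtain ⟨K, hK⟩ := h.abs_R_sub_le (half_pos hε)
  have h1 : Tendsto (fun m => K / (t m).M ^ 2 + 1 / 2 / (t m).M) atTop (nhds 0) := by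
    simpa using (tendsto_const_nhds (x := K)).div_atTop
      ((tendsto_pow_atTop two_ne_zero).comp h.tendsto_M) |>.add
        ((tendsto_const_nhds (x := (1 / 2 : ℝ))).div_atTop h.tendsto_M)
  filter_upwards [hK, h1.eventually_lt_const (half_pos hε)] with m hm hm'
  have hM := h.M_pos m
  rw [dist_eq_norm, norm_eq_abs, show ((t m).R : ℝ) / (t m).M ^ 2 - 1 / 2
    = (((t m).R : ℝ) - (t m).M ^ 2 / 2) / (t m).M ^ 2 by field_simp, abs_div,
    abs_of_pos (pow_pos hM 2)]
  refine (div_le_div_of_nonneg_right hm (by positivity)).trans_lt ?_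
  rw [show (K + ε / 2 * (t m).M ^ 2 + (t m).M / 2) / ((t m).M : ℝ) ^ 2
    = K / (t m).M ^ 2 + 1 / 2 / (t m).M + ε / 2 by field_simp; ring]
  linarith

lemma lag_mem (t : FrontState) : 0 ≤ t.lag ∧ t.lag ≤ 2 := by
  unfold lag; split <;> simp

lemma abs_time_sub_le (h : Concentrated t) (m : ℕ) :
    |((t m).time : ℝ) - (t m).R| ≤ 6 * (t m).M := by
  have hi := h.inv m
  have hb := abs_le.1 (h.balanced m)
  have h1 := pred_le hi
  have h2 := threshold_le hi.four_million_le
  have h3 := hi.four_million_le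
  have h4 := hi.one_le_c
  have h5 := hi.c_le
  have h6 := hi.b_le_two_mul
  obtain ⟨h7, h8⟩ := lag_mem (t m)
  have h7' : (0 : ℝ) ≤ (t m).lag := by exact_mod_cast h7
  have h8' : ((t m).lag : ℝ) ≤ 2 := by exact_mod_cast h8
  unfold time
  push_cast
  rw [abs_le]
  constructor <;> linarith [hb.1, hb.2]

lemma tendsto_time_div (h : Concentrated t) :
    Tendsto (fun m => ((t m).time : ℝ) / (t m).M ^ 2) atTop (nhds (1 / 2)) := by
  have h0 : Tendsto (fun m => (6 : ℝ) / (t m).M) atTop (nhds 0) :=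
    tendsto_const_nhds.div_atTop h.tendsto_M
  have h1 : Tendsto (fun m => (((t m).time : ℝ) - (t m).R) / (t m).M ^ 2) atTop (nhds 0) := by
    refine squeeze_zero_norm (fun m => ?_) h0
    have hM := h.M_pos m
    rw [norm_eq_abs, abs_div, abs_of_pos (pow_pos hM 2), div_le_div_iff₀ (by positivity) hM]
    have := mul_le_mul_of_nonneg_right (h.abs_time_sub_le m) hM.le
    linarith
  have h2 := h.tendsto_R_div.add h1
  rw [add_zero] at h2
  refine h2.congr fun m => ?_
  ring

lemma tendsto_position_div (h : Concentrated t) :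
    Tendsto (fun m => (((t m).M - (t m).lag : ℤ) : ℝ) / √(2 * (t m).time)) atTop (nhds 1) := by
  have h0 : Tendsto (fun m => (2 : ℝ) / (t m).M) atTop (nhds 0) :=
    tendsto_const_nhds.div_atTop h.tendsto_M
  have h1 : Tendsto (fun m => ((t m).lag : ℝ) / (t m).M) atTop (nhds 0) := by
    refine squeeze_zero (fun m => ?_) (fun m => ?_) h0
    · exact div_nonneg (by exact_mod_cast (lag_mem (t m)).1) (h.M_pos m).le
    · exact div_le_div_of_nonneg_right (by exact_mod_cast (lag_mem (t m)).2) (h.M_pos m).le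
  have h2 : Tendsto (fun m => √(2 * (((t m).time : ℝ) / (t m).M ^ 2))) atTop (nhds 1) := by
    simpa using (h.tendsto_time_div.const_mul 2).sqrt
  have h3 := (h1.const_sub 1).div h2 one_ne_zero
  rw [sub_zero, div_one] at h3
  refine h3.congr fun m => ?_
  have hM := h.M_pos m
  simp only [Pi.div_apply]
  rw [← mul_div_assoc, Real.sqrt_div' _ (by positivity), Real.sqrt_sq hM.le]
  push_cast
  field_simp

end Concentrated

lemma tendsto_of_alive {Ω : Type*} {X : ℕ → Ω → ℤ} {A : List Bool} {t₀ : FrontState} {ω : Ω}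
    (hd : t₀.Describes A) (hi : t₀.Inv) (h0 : X 0 ω = 0) (hs : ∀ n, |X (n + 1) ω - X n ω| = 1)
    (halive : ∀ m, frontAt A t₀ X m ω ≠ none)
    (hdev : ∀ j : ℕ, ∀ᶠ m in atTop, ω ∉ deviation A t₀ X (1 / ((j : ℝ) + 1)) m) :
    Tendsto (fun n : ℕ => (X n ω : ℝ) / √(2 * n)) atTop (nhds 1) := by
  choose t ht using fun m => Option.ne_none_iff_exists'.1 (halive m)
  have hspec := fun m => trajectory_spec hd hi (ht m)
  have hlen : ∀ m, (t m).time = (A.length + m : ℕ) := fun m => by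
    rw [← (hspec m).2.length_eq, length_pathWord]
  have hpos : ∀ m, (t m).M - (t m).lag = X (A.length + m) ω := fun m => by
    rw [← (hspec m).2.pos_eq, (pathWord_spec h0 hs _).1]
  have hstep : ∀ m, (t m).Balanced ∧ ∃ r, t (m + 1) = (t m).next r := fun m => by
    have h1 := ht (m + 1)
    rw [frontAt_succ] at h1
    obtain ⟨t', h2, h3, -, h4⟩ := step_eq_some h1
    rw [ht m, Option.some.injEq] at h2
    subst h2
    exact ⟨h3, _, h4⟩
  have hc : Concentrated t := {
    inv := fun m => (hspec m).1
    balanced := fun m => (hstep m).1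
    next_eq := fun m => (hstep m).2
    le_time := fun m => by rw [hlen]; push_cast; omega
    eventually_le := fun j => by
      filter_upwards [hdev j] with m hm
      by_contra h
      exact hm ⟨t m, ht m, not_le.1 h⟩ }
  rw [← tendsto_add_atTop_iff_nat A.length]
  refine hc.tendsto_position_div.congr fun m => ?_
  rw [hpos, hlen, add_comm m]
  push_cast
  rfl

end FrontState

open FrontState in
lemma IsDriven.measure_tendsto_pos {Ω : Type*} [MeasurableSpace Ω] {μ : Measure Ω}
    [IsProbabilityMeasure μ] {X : ℕ → Ω → ℤ} (hX : IsDriven μ X) :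
    0 < μ {ω | Tendsto (fun n : ℕ => (X n ω : ℝ) / √(2 * n)) atTop (nhds 1)} := by
  obtain ⟨k, hk⟩ := exists_nat_gt (deviationConst (1 / 10) * (2 * exp 29) + 8)
  obtain ⟨r, hr, hkr⟩ : ∃ r, 2000000 ≤ r ∧ k ≤ r :=
    ⟨max 2000000 k, le_max_left _ _, le_max_right _ _⟩
  have hd := initial_describes (r := r) (by omega)
  have hi := initial_inv hr
  have hlen : (initialWord r).length = 8 * r + 1 := by
    have := hd.length_eq
    simp only [initial, time, lag] at this
    omega
  have hlarge : deviationConst (1 / 10) * (2 * exp 29) + 8 < (initialWord r).length - 1 := by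
    have h1 : (k : ℝ) ≤ r := by exact_mod_cast hkr
    have h2 : (0 : ℝ) ≤ r := by positivity
    rw [hlen]
    push_cast
    linarith
  have hA : 2 ≤ (initialWord r).length := by omega
  refine (measure_alive_pos hX hd hi (initial_pred_sub r) hA hlarge).trans_le (measure_mono_ae ?_)
  filter_upwards [hX.zero, ae_all_iff.2 hX.step,
    ae_eventually_notMem_deviation hX hd hi (initial_pred_sub r) hA] with ω h0 hs hdev halive
  exact tendsto_of_alive hd hi h0 hs halive hdev

/-- for the walk driven by `-Δ/2`, with positive probability
`X_n / √(2n) → 1`. -/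
theorem stmt13 {Ω : Type*} [MeasurableSpace Ω] (μ : Measure Ω) [IsProbabilityMeasure μ]
    (X : ℕ → Ω → ℤ) (hmeas : ∀ n, Measurable (X n))
    (hX0 : ∀ᵐ ω ∂μ, X 0 ω = 0)
    (hstep : ∀ n, ∀ᵐ ω ∂μ, |X (n + 1) ω - X n ω| = 1)
    (hdrive : ∀ n,
      μ[(fun ω => if X (n + 1) ω = X n ω + 1 then (1 : ℝ) else 0) | walkFiltration X n]
        =ᵐ[μ] fun ω => walkF (-(Δ X n ω) / 2)) :
    0 < μ {ω | Tendsto (fun n : ℕ => (X n ω : ℝ) / Real.sqrt (2 * n)) atTop (nhds 1)} := by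
  exact IsDriven.measure_tendsto_pos ⟨hmeas, hX0, hstep, hdrive⟩
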